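/- arXiv:0807.1652 — 3 statements merged into one kernel-verified Lean document; each statement's English description precedes it below -/
import Mathlib

section
/- Let G be a finite connected simple graph with at least one vertex and let P_n be the path with n ≥ 1 edges (n + 1 vertices). Then the Cartesian (box) product G □ P_n satisfies ξ(G □ P_n) ≤ 1; equivalently, G □ P_n is upper-embeddable. -/
open SimpleGraph

/-- `T` is a spanning tree of the graph `G` (on the same vertex set). -/
def IsSpanningTree {V : Type*} (G T : SimpleGraph V) : Prop :=
  T ≤ G ∧ T.IsTree

/-- The Betti number `β(G) = |E(G)| - |V(G)| + 1` of a (finite) graph `G`. -/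
noncomputable def betti {V : Type*} (G : SimpleGraph V) : ℕ :=
  G.edgeSet.ncard + 1 - Nat.card V

/-- The number of edges of `D` lying in the connected component `c` of `D`. -/
noncomputable def compEdgeCount {V : Type*} (D : SimpleGraph V)
    (c : D.ConnectedComponent) : ℕ :=
  Set.ncard {e ∈ D.edgeSet | ∀ v ∈ e, D.connectedComponentMk v = c}

/-- The number of connected components of `D` containing an odd number of edges. -/
noncomputable def oddComps {V : Type*} (D : SimpleGraph V) : ℕ :=
  Set.ncard {c : D.ConnectedComponent | Odd (compEdgeCount D c)}

/-- `ξ(G,T)`: the number of connected components of the spanning subgraph of `G`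
with edge set `E(G) \ E(T)` that contain an odd number of edges. -/
noncomputable def xiT {V : Type*} (G T : SimpleGraph V) : ℕ :=
  oddComps (SimpleGraph.fromEdgeSet (G.edgeSet \ T.edgeSet))

/-- The Betti deficiency `ξ(G) = min_T ξ(G,T)` over all spanning trees `T` of `G`. -/
noncomputable def xi {V : Type*} (G : SimpleGraph V) : ℕ :=
  sInf {n | ∃ T, IsSpanningTree G T ∧ xiT G T = n}

/-- The fundamental cycles `C_T(e)` and `C_T(f)` (w.r.t. the spanning tree `T`)
share a vertex: writing `e = s(u₁,v₁)` and `f = s(u₂,v₂)`, the unique `T`-path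
from `u₁` to `v₁` and the unique `T`-path from `u₂` to `v₂` have a common vertex. -/
def FundCyclesMeet {V : Type*} (T : SimpleGraph V) (e f : Sym2 V) : Prop :=
  ∃ (u₁ v₁ u₂ v₂ : V), e = s(u₁, v₁) ∧ f = s(u₂, v₂) ∧
    ∃ (p : T.Walk u₁ v₁) (q : T.Walk u₂ v₂), p.IsPath ∧ q.IsPath ∧
      ∃ x, x ∈ p.support ∧ x ∈ q.support

/-- There are `2g` distinct non-tree edges `e₁, …, e_{2g}` of `G` (w.r.t. the
spanning tree `T`) such that the fundamental cycles `C_T(e_{2i-1})` and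
`C_T(e_{2i})` share a vertex for every `1 ≤ i ≤ g`. -/
def HasPairs {V : Type*} (G T : SimpleGraph V) (g : ℕ) : Prop :=
  ∃ es : Fin (2 * g) → Sym2 V, Function.Injective es ∧
    (∀ i, es i ∈ G.edgeSet \ T.edgeSet) ∧
    ∀ i : Fin g, FundCyclesMeet T
      (es ⟨2 * i.val, by have := i.2; omega⟩)
      (es ⟨2 * i.val + 1, by have := i.2; omega⟩)

/-- The graph joining every vertex `x ≠ r` to its parent `p x`. -/
def parentGraph {W : Type*} (r : W) (p : W → W) : SimpleGraph W :=
  SimpleGraph.fromRel fun x y => x ≠ r ∧ p x = y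

theorem parentGraph_adj {W : Type*} {r : W} {p : W → W} {x y : W} :
    (parentGraph r p).Adj x y ↔ x ≠ y ∧ (x ≠ r ∧ p x = y ∨ y ≠ r ∧ p y = x) := by
  simp [parentGraph]

/-- If a rank function strictly decreases along parents, the parent graph is a tree. -/
theorem parentGraph_isTree {W : Type*} [Finite W] {r : W} {p : W → W} (f : W → ℕ)
    (hf : ∀ x, x ≠ r → f (p x) < f x) : (parentGraph r p).IsTree := by
  have hreach : ∀ k x, f x = k → (parentGraph r p).Reachable x r := by
    intro k
    induction k using Nat.strong_induction_on with
    | _ k ih =>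
      intro x hx
      by_cases h : x = r
      · rw [h]
      · have hlt := hf x h
        have hadj : (parentGraph r p).Adj x (p x) :=
          parentGraph_adj.2 ⟨fun e => by rw [← e] at hlt; omega, Or.inl ⟨h, rfl⟩⟩
        exact hadj.reachable.trans (ih _ (hx ▸ hlt) _ rfl)
  have hconn : (parentGraph r p).Connected :=
    { preconnected := fun x y => (hreach _ x rfl).trans (hreach _ y rfl).symm
      nonempty := ⟨r⟩ }
  refine (SimpleGraph.isTree_iff_connected_and_card).2 ⟨hconn, ?_⟩
  refine le_antisymm ?_ hconn.card_vert_le_card_edgeSet_add_one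
  have hsub : (parentGraph r p).edgeSet ⊆ (fun x => s(x, p x)) '' {x | x ≠ r} := by
    intro e
    induction e with
    | _ x y =>
      intro h
      rcases (parentGraph_adj.1 h).2 with ⟨h1, h2⟩ | ⟨h1, h2⟩
      · exact ⟨x, h1, by simp [h2]⟩
      · exact ⟨y, h1, by simp [h2, Sym2.eq_swap]⟩
  have h1 := (Set.ncard_le_ncard hsub).trans (Set.ncard_image_le (Set.toFinite _))
  have h2 : ({x | x ≠ r} : Set W).ncard + 1 = Nat.card W := by
    have := Set.ncard_add_ncard_compl ({r} : Set W)
    rw [Set.ncard_singleton] at this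
    rw [← this, add_comm]; rfl
  rw [Nat.card_coe_set_eq]
  omega

theorem fromEdgeSet_sdiff_adj {W : Type*} {H T : SimpleGraph W} {x y : W} :
    (SimpleGraph.fromEdgeSet (H.edgeSet \ T.edgeSet)).Adj x y ↔ H.Adj x y ∧ ¬ T.Adj x y := by
  simp only [SimpleGraph.fromEdgeSet_adj, Set.mem_sdiff, SimpleGraph.mem_edgeSet]
  exact ⟨fun h => h.1, fun h => ⟨h, h.1.ne⟩⟩

/-- A graph has at most one odd component if all components other than a given one are even. -/
theorem oddComps_le_one {W : Type*} {D : SimpleGraph W} (K : D.ConnectedComponent)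
    (h : ∀ c, c ≠ K → ¬ Odd (compEdgeCount D c)) : oddComps D ≤ 1 := by
  have hsub : {c : D.ConnectedComponent | Odd (compEdgeCount D c)} ⊆ {K} := by
    intro c hc
    by_contra hne
    exact h c hne hc
  exact (Set.ncard_le_ncard hsub).trans (Set.ncard_singleton K).le

theorem xi_le_xiT {W : Type*} {H T : SimpleGraph W} (hT : IsSpanningTree H T) :
    xi H ≤ xiT H T :=
  Nat.sInf_le ⟨T, hT, rfl⟩

open Classical in
/-- The parent function of the spanning tree of `G □ P_n`: layer `0` uses the parent function `p`
of `G`, and the other layers hang below the previous layer, except that vertices of `X` in layer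
`1` and vertices of `Y` in the layers above are attached inside their own layer. -/
noncomputable def boxParent {V : Type*} (p q : V → V) (X Y : Set V) {n : ℕ}
    (x : V × Fin (n + 1)) : V × Fin (n + 1) :=
  if x.2.val = 0 then (p x.1, x.2)
  else if x.2.val = 1 ∧ x.1 ∈ X then (q x.1, x.2)
  else if 2 ≤ x.2.val ∧ x.1 ∈ Y then (p x.1, x.2)
  else (x.1, ⟨x.2.val - 1, by omega⟩)

section BoxParent

variable {V : Type*} {p q : V → V} {X Y : Set V} {n : ℕ} {v : V} {i : Fin (n + 1)}

theorem boxParent_zero (h : i.val = 0) : boxParent p q X Y (v, i) = (p v, i) := by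
  simp [boxParent, h]

theorem boxParent_one_mem (h : i.val = 1) (hv : v ∈ X) :
    boxParent p q X Y (v, i) = (q v, i) := by
  simp [boxParent, h, hv]

theorem boxParent_two_mem (h : 2 ≤ i.val) (hv : v ∈ Y) :
    boxParent p q X Y (v, i) = (p v, i) := by
  simp [boxParent, h, hv, show i.val ≠ 1 by omega, show i ≠ 0 by rintro rfl; simp at h]

theorem boxParent_of_notMem (h : i.val ≠ 0) (hX : i.val = 1 → v ∉ X) (hY : 2 ≤ i.val → v ∉ Y) :
    boxParent p q X Y (v, i) = (v, ⟨i.val - 1, by omega⟩) := by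
  have h1 : ¬ (i.val = 1 ∧ v ∈ X) := fun h => hX h.1 h.2
  have h2 : ¬ (2 ≤ i.val ∧ v ∈ Y) := fun h => hY h.1 h.2
  simp only [boxParent, h, h1, h2, if_false]

end BoxParent

/-- The tree of `boxParent` is a spanning tree of `G □ P_n`. -/
theorem isSpanningTree_boxParent {V : Type*} [Finite V] {G : SimpleGraph V} {r : V}
    {p q : V → V} {d : V → ℕ} {X Y : Set V} {n : ℕ}
    (hp : ∀ v, v ≠ r → G.Adj v (p v) ∧ d (p v) < d v)
    (hq : ∀ v ∈ X, G.Adj v (q v) ∧ q v ∉ X)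
    (hrY : r ∉ Y) (hpY : ∀ v, v ≠ r → p v ∉ Y) :
    IsSpanningTree (G.boxProd (SimpleGraph.pathGraph (n + 1)))
      (parentGraph (r, 0) (boxParent (n := n) p q X Y)) := by
  classical
  have hadj : ∀ x : V × Fin (n + 1), x ≠ (r, 0) →
      (G.boxProd (SimpleGraph.pathGraph (n + 1))).Adj x (boxParent p q X Y x) := by
    rintro ⟨v, i⟩ hx
    by_cases h0 : i.val = 0
    · have hi : i = 0 := Fin.ext h0
      have hv : v ≠ r := fun h => hx (by rw [h, hi])
      rw [boxParent_zero h0]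
      exact SimpleGraph.boxProd_adj_left.2 (hp v hv).1
    by_cases h1 : i.val = 1 ∧ v ∈ X
    · rw [boxParent_one_mem h1.1 h1.2]
      exact SimpleGraph.boxProd_adj_left.2 (hq v h1.2).1
    by_cases h2 : 2 ≤ i.val ∧ v ∈ Y
    · rw [boxParent_two_mem h2.1 h2.2]
      exact SimpleGraph.boxProd_adj_left.2 (hp v fun h => hrY (h ▸ h2.2)).1
    · rw [boxParent_of_notMem h0 (fun a b => h1 ⟨a, b⟩) (fun a b => h2 ⟨a, b⟩)]
      refine SimpleGraph.boxProd_adj_right.2 (SimpleGraph.pathGraph_adj.2 (Or.inr ?_))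
      simp only
      omega
  constructor
  · intro x y h
    rcases (parentGraph_adj.1 h).2 with ⟨h1, rfl⟩ | ⟨h1, rfl⟩
    · exact hadj _ h1
    · exact (hadj _ h1).symm
  · obtain ⟨N, hN⟩ := (Set.finite_range d).bddAbove
    have hN' : ∀ v, d v ≤ N := fun v => hN ⟨v, rfl⟩
    refine parentGraph_isTree
      (fun x => if x.2.val = 0 then d x.1 else N + 2 * x.2.val +
        if x.2.val = 1 ∧ x.1 ∈ X ∨ 2 ≤ x.2.val ∧ x.1 ∈ Y then 1 else 0) ?_
    rintro ⟨v, i⟩ hx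
    by_cases h0 : i.val = 0
    · have hi : i = 0 := Fin.ext h0
      have hv : v ≠ r := fun h => hx (by rw [h, hi])
      rw [boxParent_zero h0]
      simpa [h0] using (hp v hv).2
    by_cases h1 : i.val = 1 ∧ v ∈ X
    · rw [boxParent_one_mem h1.1 h1.2]
      simp [h1.1, h1.2, (hq v h1.2).2]
    by_cases h2 : 2 ≤ i.val ∧ v ∈ Y
    · rw [boxParent_two_mem h2.1 h2.2]
      have hne : v ≠ r := fun h => hrY (h ▸ h2.2)
      simp only [h0, if_false, h2.1, h2.2, hpY v hne]
      have : i.val ≠ 1 := by omega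
      simp [this]
    · rw [boxParent_of_notMem h0 (fun a b => h1 ⟨a, b⟩) (fun a b => h2 ⟨a, b⟩)]
      have := hN' v
      simp only [h0, if_false, h1, h2, or_false]
      split_ifs <;> omega

/-- Criterion for `ξ(G □ P_n) ≤ 1`: every component with an edge of the cotree, other than the
one containing layer `1` is a copy of `G` without the edges `{v, p v}`, `v ∈ Y`. -/
theorem xi_boxProd_le_one_of_parent {V : Type*} [Finite V] {G : SimpleGraph V} {r : V}
    {p q : V → V} {d : V → ℕ} {X Y : Set V} {n : ℕ} (hn : 1 ≤ n)
    (hp : ∀ v, v ≠ r → G.Adj v (p v) ∧ d (p v) < d v)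
    (hq : ∀ v ∈ X, G.Adj v (q v) ∧ q v ∉ X ∧ ¬ (parentGraph r p).Adj v (q v))
    (hX : ∀ a b, G.Adj a b → ¬ (parentGraph r p).Adj a b →
      ∃ x ∈ X, (SimpleGraph.fromEdgeSet (G.edgeSet \ (parentGraph r p).edgeSet)).Reachable a x)
    (hYs : Y.Subsingleton) (hrY : r ∉ Y) (hpY : ∀ v, v ≠ r → p v ∉ Y)
    (heven : Even {e ∈ G.edgeSet | ∀ v ∈ Y, e ≠ s(v, p v)}.ncard) :
    xi (G.boxProd (SimpleGraph.pathGraph (n + 1))) ≤ 1 := by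
  classical
  set H := G.boxProd (SimpleGraph.pathGraph (n + 1)) with hH
  set T := parentGraph (r, 0) (boxParent (n := n) p q X Y) with hT
  refine (xi_le_xiT (isSpanningTree_boxParent hp (fun v hv => ⟨(hq v hv).1, (hq v hv).2.1⟩)
    hrY hpY)).trans ?_
  unfold xiT
  set D := SimpleGraph.fromEdgeSet (H.edgeSet \ T.edgeSet) with hD
  let one : Fin (n + 1) := ⟨1, by omega⟩
  have hDadj : ∀ {x y}, D.Adj x y ↔ H.Adj x y ∧ ¬ T.Adj x y := fromEdgeSet_sdiff_adj
  have hpne : ∀ v, v ≠ r → p v ≠ v := fun v hv h => by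
    have := (hp v hv).2
    rw [h] at this
    omega
  -- cotree edges inside a layer
  have layer_zero : ∀ a b, D.Adj (a, (0 : Fin (n + 1))) (b, 0) ↔
      G.Adj a b ∧ ¬ (parentGraph r p).Adj a b := by
    intro a b
    rw [hDadj, hH, SimpleGraph.boxProd_adj_left, hT, parentGraph_adj, parentGraph_adj,
      boxParent_zero rfl, boxParent_zero rfl]
    simp [Prod.ext_iff]
  have layer_one : ∀ a b, D.Adj (a, one) (b, one) ↔
      G.Adj a b ∧ ¬ (a ∈ X ∧ q a = b ∨ b ∈ X ∧ q b = a) := by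
    have key : ∀ a b, a ≠ b → (boxParent p q X Y (a, one) = (b, one) ↔ a ∈ X ∧ q a = b) := by
      intro a b hab
      by_cases ha : a ∈ X
      · rw [boxParent_one_mem rfl ha]
        simp [ha]
      · rw [boxParent_of_notMem (by simp [one]) (fun _ => ha) (fun h => by simp [one] at h)]
        simp [ha, hab]
    have hne : ∀ a, (a, one) ≠ (r, (0 : Fin (n + 1))) := by
      intro a h
      have := congrArg (fun x => x.2.val) h
      simp [one] at this
    intro a b
    rw [hDadj, hH, SimpleGraph.boxProd_adj_left, hT, parentGraph_adj]
    refine and_congr_right fun h => not_congr ?_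
    rw [key a b h.ne, key b a h.ne']
    simp [hne, h.ne]
  have layer_two : ∀ a b (i : Fin (n + 1)), 2 ≤ i.val → (D.Adj (a, i) (b, i) ↔
      G.Adj a b ∧ ∀ v ∈ Y, s(a, b) ≠ s(v, p v)) := by
    have key : ∀ a b (i : Fin (n + 1)), 2 ≤ i.val → a ≠ b →
        (boxParent p q X Y (a, i) = (b, i) ↔ a ∈ Y ∧ p a = b) := by
      intro a b i hi hab
      by_cases ha : a ∈ Y
      · rw [boxParent_two_mem hi ha]
        simp [ha]
      · rw [boxParent_of_notMem (by omega) (fun h => by omega) (fun _ => ha)]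
        simp [ha, hab]
    intro a b i hi
    have hne : ∀ a, (a, i) ≠ (r, (0 : Fin (n + 1))) := by
      intro a h
      have := congrArg (fun x => x.2.val) h
      simp at this
      simp [this] at hi
    rw [hDadj, hH, SimpleGraph.boxProd_adj_left, hT, parentGraph_adj]
    refine and_congr_right fun h => ?_
    rw [key a b i hi h.ne, key b a i hi h.ne']
    have hab : (a, i) ≠ (b, i) := fun e => h.ne (congrArg Prod.fst e)
    constructor
    · intro h1 v hv he
      refine h1 ⟨hab, ?_⟩
      rcases Sym2.eq_iff.1 he with ⟨rfl, h3⟩ | ⟨h3, rfl⟩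
      · exact Or.inl ⟨hne _, hv, h3.symm⟩
      · exact Or.inr ⟨hne _, hv, h3.symm⟩
    · rintro h1 ⟨-, ⟨-, h2, h3⟩ | ⟨-, h2, h3⟩⟩
      · exact h1 a h2 (by rw [h3])
      · exact h1 b h2 (by rw [h3, Sym2.eq_swap])
  -- cotree edges between layers
  have rung : ∀ v (i j : Fin (n + 1)), i.val + 1 = j.val → (D.Adj (v, i) (v, j) ↔
      (j.val = 1 ∧ v ∈ X ∨ 2 ≤ j.val ∧ v ∈ Y)) := by
    intro v i j hij
    have hjne : (v, j) ≠ (r, (0 : Fin (n + 1))) := by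
      intro h
      have := congrArg (fun x => x.2.val) h
      simp at this
      simp [this] at hij
    have hne : (v, i) ≠ (v, j) := by
      intro h
      have := congrArg (fun x => x.2.val) h
      simp only at this
      omega
    have hi : boxParent p q X Y (v, i) ≠ (v, j) := by
      intro h
      have := congrArg (fun x => x.2.val) h
      unfold boxParent at this
      split_ifs at this <;> simp only at this <;> omega
    have hHadj : H.Adj (v, i) (v, j) :=
      SimpleGraph.boxProd_adj_right.2 (SimpleGraph.pathGraph_adj.2 (Or.inl hij))
    rw [hDadj, hT, parentGraph_adj]
    by_cases hx : j.val = 1 ∧ v ∈ X ∨ 2 ≤ j.val ∧ v ∈ Y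
    · refine iff_of_true ⟨hHadj, ?_⟩ hx
      have : boxParent p q X Y (v, j) ≠ (v, i) := by
        intro h
        have h' := congrArg (fun x => x.2.val) h
        rcases hx with ⟨h1, h2⟩ | ⟨h1, h2⟩
        · rw [boxParent_one_mem h1 h2] at h'
          simp only at h'
          omega
        · rw [boxParent_two_mem h1 h2] at h'
          simp only at h'
          omega
      tauto
    · refine iff_of_false (fun h => h.2 ⟨hne, Or.inr ⟨hjne, ?_⟩⟩) hx
      rw [boxParent_of_notMem (by omega) (fun a b => hx (Or.inl ⟨a, b⟩))
        (fun a b => hx (Or.inr ⟨a, b⟩))]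
      simp only [Prod.mk.injEq, true_and]
      exact Fin.ext (by simp only; omega)
  -- the root is joined to every vertex of its layer outside `Y`
  have climb : ∀ i : Fin (n + 1), (∀ v, v ≠ r → (2 ≤ i.val → v ∉ Y) →
      D.Adj (v, i) (p v, i)) → ∀ v, (2 ≤ i.val → v ∉ Y) → D.Reachable (v, i) (r, i) := by
    intro i hi
    have : ∀ k v, d v = k → (2 ≤ i.val → v ∉ Y) → D.Reachable (v, i) (r, i) := by
      intro k
      induction k using Nat.strong_induction_on with
      | _ k ih =>
        intro v hv hY
        by_cases hvr : v = r
        · rw [hvr]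
        · exact (hi v hvr hY).reachable.trans
            (ih _ (hv ▸ (hp v hvr).2) _ rfl fun _ => hpY v hvr)
    exact fun v => this _ v rfl
  have padj : ∀ v, v ≠ r → (parentGraph r p).Adj v (p v) := fun v hv =>
    parentGraph_adj.2 ⟨(hpne v hv).symm, Or.inl ⟨hv, rfl⟩⟩
  have reach_one : ∀ v, D.Reachable (v, one) (r, one) := by
    refine fun v => climb one (fun v hv _ => ?_) v (fun h => by simp [one] at h)
    refine (layer_one _ _).2 ⟨(hp v hv).1, ?_⟩
    rintro (⟨h1, h2⟩ | ⟨h1, h2⟩)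
    · exact (hq v h1).2.2 (h2 ▸ padj v hv)
    · exact (hq _ h1).2.2 (h2.symm ▸ (padj v hv).symm)
  have reach_two : ∀ (i : Fin (n + 1)), 2 ≤ i.val → ∀ v, v ∉ Y →
      D.Reachable (v, i) (r, i) := by
    refine fun i hi v hv => climb i (fun v hvr hv => ?_) v fun _ => hv
    refine (layer_two _ _ _ hi).2 ⟨(hp v hvr).1, fun w hw he => ?_⟩
    rcases Sym2.eq_iff.1 he with ⟨rfl, -⟩ | ⟨-, rfl⟩
    · exact hv hi hw
    · exact hpY v hvr hw
  have reach_zero : ∀ a b, D.Adj (a, (0 : Fin (n + 1))) (b, 0) →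
      D.Reachable (a, 0) (r, one) := by
    intro a b hab
    obtain ⟨h1, h2⟩ := (layer_zero a b).1 hab
    obtain ⟨x, hx, hax⟩ := hX a b h1 h2
    let φ : SimpleGraph.fromEdgeSet (G.edgeSet \ (parentGraph r p).edgeSet) →g D :=
      ⟨fun v => (v, 0), fun {u v} huv => (layer_zero u v).2 (fromEdgeSet_sdiff_adj.1 huv)⟩
    have h3 : D.Reachable (a, 0) (x, 0) := hax.map φ
    have h4 : D.Adj (x, 0) (x, one) := (rung x 0 one rfl).2 (Or.inl ⟨rfl, hx⟩)
    exact h3.trans (h4.reachable.trans (reach_one x))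
  have reach_Y : ∀ v ∈ Y, ∀ k (hk : k < n + 1), 1 ≤ k → D.Reachable (v, ⟨k, hk⟩) (r, one) := by
    intro v hv k hk hk1
    induction k, hk1 using Nat.le_induction with
    | base => exact reach_one v
    | succ k hk1 ih =>
      have hadj : D.Adj (v, ⟨k, by omega⟩) (v, ⟨k + 1, hk⟩) :=
        (rung v _ _ rfl).2 (Or.inr ⟨by simp only; omega, hv⟩)
      exact hadj.symm.reachable.trans (ih (by omega))
  -- an edge outside the main component lies in a layer and avoids `Y`
  have edge_cases : ∀ v i w j, D.Adj (v, i) (w, j) → ¬ D.Reachable (v, i) (r, one) →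
      i = j ∧ 2 ≤ i.val ∧ v ∉ Y := by
    intro v i w j hadj hnr
    have hnr' : ¬ D.Reachable (w, j) (r, one) := fun h => hnr (hadj.reachable.trans h)
    have hone : ∀ v (i : Fin (n + 1)), i.val = 1 → D.Reachable (v, i) (r, one) := by
      intro v i hi
      have : i = one := Fin.ext hi
      exact this ▸ reach_one v
    have hY : 1 ≤ i.val → v ∉ Y := fun h hv => hnr (reach_Y v hv i.val i.isLt h)
    have hY' : 1 ≤ j.val → w ∉ Y := fun h hv => hnr' (reach_Y w hv j.val j.isLt h)
    have h1 : i.val ≠ 1 := fun h => hnr (hone v i h)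
    have h1' : j.val ≠ 1 := fun h => hnr' (hone w j h)
    rcases SimpleGraph.boxProd_adj.1 (hDadj.1 hadj).1 with ⟨-, h2⟩ | ⟨h2, h3⟩
    · have hij : i = j := h2
      subst hij
      have h0 : i.val ≠ 0 := by
        intro h0
        have : i = 0 := Fin.ext h0
        subst this
        exact hnr (reach_zero v w hadj)
      exact ⟨rfl, by omega, hY (by omega)⟩
    · have hvw : v = w := h3
      subst hvw
      rcases SimpleGraph.pathGraph_adj.1 h2 with h4 | h4
      · rcases (rung v i j h4).1 hadj with h5 | h5
        · exact absurd h5.1 h1'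
        · exact absurd h5.2 (hY' (by omega))
      · rcases (rung v j i h4).1 hadj.symm with h5 | h5
        · exact absurd h5.1 h1
        · exact absurd h5.2 (hY (by omega))
  refine oddComps_le_one (D.connectedComponentMk (r, one)) fun c hc => ?_
  rw [Nat.not_odd_iff_even]
  unfold compEdgeCount
  rcases Set.eq_empty_or_nonempty
    {e ∈ D.edgeSet | ∀ v ∈ e, D.connectedComponentMk v = c} with hemp | ⟨e, he⟩
  · rw [hemp]
    simp
  obtain ⟨i, hi, hci⟩ : ∃ i : Fin (n + 1), 2 ≤ i.val ∧ D.connectedComponentMk (r, i) = c := by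
    induction e with
    | _ x y =>
      obtain ⟨v, i⟩ := x
      obtain ⟨w, j⟩ := y
      have hv : D.connectedComponentMk (v, i) = c := he.2 _ (by simp)
      have hnr : ¬ D.Reachable (v, i) (r, one) := fun h =>
        hc (hv ▸ SimpleGraph.ConnectedComponent.eq.2 h)
      obtain ⟨-, h2, h3⟩ := edge_cases v i w j he.1 hnr
      exact ⟨i, h2, hv ▸ SimpleGraph.ConnectedComponent.eq.2 (reach_two i h2 v h3).symm⟩
  have hnr : ∀ x, D.connectedComponentMk x = c → ¬ D.Reachable x (r, one) := fun x hx h =>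
    hc (hx ▸ SimpleGraph.ConnectedComponent.eq.2 h)
  have same_layer : ∀ x, D.connectedComponentMk x = c → x.2 = i := by
    intro x hx
    have hr : D.Reachable (r, i) x := SimpleGraph.ConnectedComponent.eq.1 (hci.trans hx.symm)
    rw [SimpleGraph.reachable_iff_reflTransGen] at hr
    suffices ∀ y, Relation.ReflTransGen D.Adj (r, i) y → y.2 = i from this x hr
    intro y hy
    induction hy with
    | refl => rfl
    | tail h1 h2 ih =>
      rw [← ih]
      refine (edge_cases _ _ _ _ h2 (hnr _ ?_)).1.symm
      rw [← hci]
      exact SimpleGraph.ConnectedComponent.eq.2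
        ((SimpleGraph.reachable_iff_reflTransGen _ _).2 h1).symm
  have himage : {e ∈ D.edgeSet | ∀ v ∈ e, D.connectedComponentMk v = c} =
      Sym2.map (fun v => (v, i)) '' {e ∈ G.edgeSet | ∀ v ∈ Y, e ≠ s(v, p v)} := by
    ext e
    constructor
    · induction e with
      | _ x y =>
        intro he
        obtain ⟨v, j⟩ := x
        obtain ⟨w, k⟩ := y
        obtain rfl : j = i := same_layer _ (he.2 (v, j) (by simp))
        obtain rfl : k = j := same_layer _ (he.2 (w, k) (by simp))
        exact ⟨s(v, w), (layer_two v w k hi).1 he.1, rfl⟩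
    · rintro ⟨e, he, rfl⟩
      induction e with
      | _ v w =>
        have hadj : D.Adj (v, i) (w, i) := (layer_two v w i hi).2 he
        have hadj' := hadj.reachable
        have hcomp : D.connectedComponentMk (v, i) = c := by
          rw [← hci]
          refine SimpleGraph.ConnectedComponent.eq.2 ?_
          by_cases hv : v ∈ Y
          · exact hadj'.trans (reach_two i hi w fun hw => he.1.ne (hYs hv hw))
          · exact reach_two i hi v hv
        refine ⟨hadj, fun x hx => ?_⟩
        rcases Sym2.mem_iff.1 hx with rfl | rfl
        · exact hcomp
        · rw [← hcomp]
          exact SimpleGraph.ConnectedComponent.eq.2 hadj'.symm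
  rw [himage, Set.ncard_image_of_injective _
    (Sym2.map.injective fun a b h => congrArg Prod.fst h)]
  exact heven

/-- In every graph one can choose a vertex set `X` that has exactly one vertex in each nontrivial
component, together with a neighbour outside `X` for each of its vertices. -/
theorem exists_nontrivial_component_reps {V : Type*} (Q : SimpleGraph V) :
    ∃ (X : Set V) (q : V → V), (∀ v ∈ X, Q.Adj v (q v) ∧ q v ∉ X) ∧
      ∀ a b, Q.Adj a b → ∃ x ∈ X, Q.Reachable a x := by
  classical
  let rep : V → V := fun v => (Q.connectedComponentMk v).out
  have hrep : ∀ v, Q.Reachable v (rep v) := fun v =>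
    (SimpleGraph.ConnectedComponent.eq.1 (Quot.out_eq (Q.connectedComponentMk v))).symm
  have hrep_eq : ∀ v w, Q.Reachable v w → rep v = rep w := fun v w h =>
    congrArg (fun c : Q.ConnectedComponent => c.out) (SimpleGraph.ConnectedComponent.eq.2 h)
  refine ⟨{v | rep v = v ∧ ∃ w, Q.Adj v w}, fun v => if h : ∃ w, Q.Adj v w then h.choose else v,
    ?_, ?_⟩
  · rintro v ⟨hv, hw⟩
    have hadj : Q.Adj v hw.choose := hw.choose_spec
    simp only [hw, dif_pos]
    refine ⟨hadj, fun hmem => hadj.ne ?_⟩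
    exact hv.symm.trans ((hrep_eq _ _ hadj.reachable).trans hmem.1)
  · intro a b hab
    refine ⟨rep a, ⟨(hrep_eq _ _ (hrep a)).symm, ?_⟩, hrep a⟩
    by_cases h : a = rep a
    · exact ⟨b, h ▸ hab⟩
    · have hr := (hrep a).symm
      generalize rep a = x at h hr
      obtain ⟨w⟩ := hr
      cases w with
      | nil => exact absurd rfl h
      | cons hadj _ => exact ⟨_, hadj⟩

/-- A connected graph has a parent function decreasing the distance to a given root. -/
theorem exists_parent_dist_lt {V : Type*} {G : SimpleGraph V} (hG : G.Connected) (r : V) :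
    ∃ p : V → V, ∀ v, v ≠ r → G.Adj v (p v) ∧ G.dist r (p v) < G.dist r v := by
  have : ∀ v, ∃ w, v ≠ r → G.Adj v w ∧ G.dist r w < G.dist r v := by
    intro v
    by_cases hv : v = r
    · exact ⟨v, fun h => absurd hv h⟩
    · obtain ⟨w, hw⟩ := (hG v r).exists_walk_length_eq_dist
      cases w with
      | nil => exact absurd rfl hv
      | @cons _ u _ hadj w =>
        refine ⟨u, fun _ => ⟨hadj, ?_⟩⟩
        rw [SimpleGraph.dist_comm, SimpleGraph.dist_comm (u := r), ← hw,
          SimpleGraph.Walk.length_cons]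
        exact Nat.lt_succ_of_le (SimpleGraph.dist_le w)
  choose p hp using this
  exact ⟨p, hp⟩

/-- The Cartesian (box) product of a finite connected simple graph with
a path `P_n` (`n ≥ 1` edges) is upper-embeddable: `ξ(G □ P_n) ≤ 1`. -/
theorem boxProd_path_upper_embeddable {V : Type*} [Finite V]
    (G : SimpleGraph V) (hG : G.Connected) (n : ℕ) (hn : 1 ≤ n) :
    xi (G.boxProd (SimpleGraph.pathGraph (n + 1))) ≤ 1 := by
  obtain ⟨r⟩ := hG.nonempty
  obtain ⟨p, hp⟩ := exists_parent_dist_lt hG r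
  obtain ⟨X, q, hq, hX⟩ := exists_nontrivial_component_reps
    (SimpleGraph.fromEdgeSet (G.edgeSet \ (parentGraph r p).edgeSet))
  have hq' : ∀ v ∈ X, G.Adj v (q v) ∧ q v ∉ X ∧ ¬ (parentGraph r p).Adj v (q v) := by
    intro v hv
    have h := fromEdgeSet_sdiff_adj.1 (hq v hv).1
    exact ⟨h.1, (hq v hv).2, h.2⟩
  have hX' := fun a b hab hn => hX a b (fromEdgeSet_sdiff_adj.2 ⟨hab, hn⟩)
  rcases Nat.even_or_odd G.edgeSet.ncard with heven | hodd
  · exact xi_boxProd_le_one_of_parent hn hp hq' hX' Set.subsingleton_empty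
      (Set.notMem_empty r) (fun v _ => Set.notMem_empty (p v)) (by simpa using heven)
  · have : Nonempty V := ⟨r⟩
    obtain ⟨u, hu⟩ := Finite.exists_max (G.dist r)
    have hur : u ≠ r := by
      rintro rfl
      obtain ⟨e, he⟩ := Set.nonempty_of_ncard_ne_zero hodd.pos.ne'
      induction e with
      | _ a b =>
        have h0 : ∀ v, u = v := fun v => (hG u v).dist_eq_zero_iff.1
          (Nat.le_zero.1 (by simpa using hu v))
        exact he.ne ((h0 a).symm.trans (h0 b))
    refine xi_boxProd_le_one_of_parent hn hp hq' hX' (Y := {u}) Set.subsingleton_singleton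
      (fun h => hur (Set.mem_singleton_iff.1 h).symm)
      (fun v hv h => ?_) ?_
    · have h1 := (hp v hv).2
      rw [Set.mem_singleton_iff.1 h] at h1
      exact absurd h1 (hu v).not_gt
    · have hset : {e ∈ G.edgeSet | ∀ v ∈ ({u} : Set V), e ≠ s(v, p v)} =
          G.edgeSet \ {s(u, p u)} := by
        ext e
        simp
      rw [hset, Set.ncard_sdiff_singleton_of_mem ((G.mem_edgeSet).2 (hp u hur).1)]
      exact Nat.Odd.sub_odd hodd odd_one
end

section
/- Let n ≥ 3 and let k be an integer with k ≢ 0 (mod n). The generalized Petersen graph P(n,k) satisfies ξ(P(n,k)) ≤ 1; equivalently, P(n,k) is upper-embeddable. -/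
open SimpleGraph

/-- The generalized Petersen graph `P(n, k)`: vertices `u_i = Sum.inl i` and
`v_i = Sum.inr i` for `i : ZMod n`, with edges `u_i u_{i+1}`, `u_i v_i` and
`v_i v_{i+k}` for all `i`. -/
def genPetersen (n : ℕ) (k : ℤ) : SimpleGraph (ZMod n ⊕ ZMod n) :=
  SimpleGraph.fromRel fun a b =>
    (∃ i : ZMod n, a = Sum.inl i ∧ b = Sum.inl (i + 1)) ∨
    (∃ i : ZMod n, a = Sum.inl i ∧ b = Sum.inr i) ∨
    (∃ i : ZMod n, a = Sum.inr i ∧ b = Sum.inr (i + (k : ZMod n)))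

/-- If the edges of `D` outside one component `c₀` split into pairs `f a, g a` of adjacent edges,
then `D` has at most one component with an odd number of edges. -/
theorem oddComps_le_one_s13 {V ι : Type*} [Finite ι] (D : SimpleGraph V)
    (c₀ : D.ConnectedComponent) (X : Set ι) (f g : ι → Sym2 V) (w : ι → V)
    (hf : ∀ a ∈ X, f a ∈ D.edgeSet ∧ w a ∈ f a) (hg : ∀ a ∈ X, g a ∈ D.edgeSet ∧ w a ∈ g a)
    (hfi : Set.InjOn f X) (hgi : Set.InjOn g X) (hfg : ∀ a ∈ X, ∀ b ∈ X, f a ≠ g b)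
    (hD : ∀ e ∈ D.edgeSet,
      (∃ a ∈ X, e = f a ∨ e = g a) ∨ ∃ v ∈ e, D.connectedComponentMk v = c₀) :
    oddComps D ≤ 1 := by
  have key : ∀ e ∈ D.edgeSet, ∀ x ∈ e, ∀ y ∈ e,
      D.connectedComponentMk x = D.connectedComponentMk y := by
    intro e he
    induction e using Sym2.ind with
    | _ a b =>
      have hab : D.connectedComponentMk a = D.connectedComponentMk b :=
        ConnectedComponent.sound (Adj.reachable he)
      intro x hx y hy
      rw [Sym2.mem_iff] at hx hy
      rcases hx with rfl | rfl <;> rcases hy with rfl | rfl <;> simp [hab]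
  have hsub : {c : D.ConnectedComponent | Odd (compEdgeCount D c)} ⊆ {c₀} := by
    intro c hc
    by_contra hne
    simp only [Set.mem_singleton_iff] at hne
    set Y : Set ι := {a ∈ X | D.connectedComponentMk (w a) = c} with hY
    have hE : {e ∈ D.edgeSet | ∀ v ∈ e, D.connectedComponentMk v = c} = f '' Y ∪ g '' Y := by
      ext e
      constructor
      · rintro ⟨he, hv⟩
        rcases hD e he with ⟨a, ha, rfl | rfl⟩ | ⟨v, hve, hvc⟩
        · exact Or.inl ⟨a, ⟨ha, hv _ (hf a ha).2⟩, rfl⟩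
        · exact Or.inr ⟨a, ⟨ha, hv _ (hg a ha).2⟩, rfl⟩
        · exact absurd ((hv v hve).symm.trans hvc) hne
      · rintro (⟨a, ⟨ha, hac⟩, rfl⟩ | ⟨a, ⟨ha, hac⟩, rfl⟩)
        · exact ⟨(hf a ha).1, fun v hv => (key _ (hf a ha).1 v hv _ (hf a ha).2).trans hac⟩
        · exact ⟨(hg a ha).1, fun v hv => (key _ (hg a ha).1 v hv _ (hg a ha).2).trans hac⟩
    have hdisj : Disjoint (f '' Y) (g '' Y) := by
      rw [Set.disjoint_left]
      rintro _ ⟨a, ha, rfl⟩ ⟨b, hb, hab⟩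
      exact hfg a ha.1 b hb.1 hab.symm
    have hcount : compEdgeCount D c = Y.ncard + Y.ncard := by
      rw [compEdgeCount, hE, Set.ncard_union_eq hdisj (Set.toFinite _) (Set.toFinite _),
        (hfi.mono fun _ h => h.1).ncard_image,
        (hgi.mono fun _ h => h.1).ncard_image]
    rw [Set.mem_ofPred_eq, hcount] at hc
    exact Nat.not_odd_iff_even.2 ⟨_, rfl⟩ hc
  exact (Set.ncard_le_ncard hsub).trans (Set.ncard_singleton c₀).le

/-- A connected graph with fewer edges than vertices is a tree. -/
theorem isTree_of_connected_of_ncard_edgeSet_lt {V : Type*} [Finite V] {T : SimpleGraph V}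
    (hT : T.Connected) (h : T.edgeSet.ncard + 1 ≤ Nat.card V) : T.IsTree := by
  rw [isTree_iff_connected_and_card]
  refine ⟨hT, le_antisymm ?_ ?_⟩
  · rwa [Nat.card_coe_set_eq]
  · exact hT.card_vert_le_card_edgeSet_add_one

theorem reachable_of_adj_succ {V : Type*} {H : SimpleGraph V} (x : ℕ → V) {s t : ℕ}
    (h : ∀ j, s ≤ j → j < t → H.Adj (x j) (x (j + 1))) {j : ℕ} (hs : s ≤ j) (ht : j ≤ t) :
    H.Reachable (x s) (x j) := by
  induction j, hs using Nat.le_induction with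
  | base => exact Reachable.refl _
  | succ j hj ih => exact (ih (by omega)).trans (h j hj (by omega)).reachable

theorem ZMod.ncard_val_mem_Ico_le {n : ℕ} [NeZero n] (a b : ℕ) :
    {i : ZMod n | a ≤ i.val ∧ i.val < b}.ncard ≤ b - a := by
  have h := Set.ncard_le_ncard_of_injOn (s := {i : ZMod n | a ≤ i.val ∧ i.val < b})
    (t := (Finset.Ico a b : Set ℕ)) ZMod.val (fun i hi => by simpa using hi)
    (ZMod.val_injective n).injOn
  simpa [Set.ncard_coe_finset] using h

namespace GenPetersen

/-- The edge `u_i u_{i+1}`. -/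
def outer {n : ℕ} (i : ZMod n) : Sym2 (ZMod n ⊕ ZMod n) := s(Sum.inl i, Sum.inl (i + 1))

/-- The edge `u_i v_i`. -/
def spoke {n : ℕ} (i : ZMod n) : Sym2 (ZMod n ⊕ ZMod n) := s(Sum.inl i, Sum.inr i)

/-- The edge `v_i v_{i+k}`. -/
def inner {n : ℕ} (k i : ZMod n) : Sym2 (ZMod n ⊕ ZMod n) := s(Sum.inr i, Sum.inr (i + k))

/-- The set of outer edges with index satisfying `P` and of spokes and inner edges with index
satisfying `Q`. -/
def removed {n : ℕ} (k : ZMod n) (P Q : ZMod n → Prop) : Set (Sym2 (ZMod n ⊕ ZMod n)) :=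
  {e | (∃ i, P i ∧ e = outer i) ∨ (∃ i, Q i ∧ e = spoke i) ∨ ∃ i, Q i ∧ e = inner k i}

variable {n : ℕ} {k : ℤ} {P Q : ZMod n → Prop}

theorem outer_ne_spoke (i j : ZMod n) : outer i ≠ spoke j := by
  simp [outer, spoke]

theorem outer_ne_inner (k i j : ZMod n) : outer i ≠ inner k j := by
  simp [outer, inner]

theorem spoke_ne_inner (k i j : ZMod n) : spoke i ≠ inner k j := by
  simp [spoke, inner]

theorem spoke_injective : Function.Injective (spoke (n := n)) := by
  intro i j h
  simpa [spoke] using h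

theorem inner_injective {k : ZMod n} (hk : k + k ≠ 0) : Function.Injective (inner k) := by
  intro i j h
  simp only [inner, Sym2.eq_iff, Sum.inr.injEq] at h
  rcases h with ⟨h, -⟩ | ⟨h₁, h₂⟩
  · exact h
  · exact absurd (by linear_combination h₂ - h₁) hk

theorem one_add_one_ne_zero (hn : 3 ≤ n) : (1 : ZMod n) + 1 ≠ 0 := by
  intro h
  have h2 : ((2 : ℕ) : ZMod n) = 0 := by
    rw [Nat.cast_two, ← one_add_one_eq_two, h]
  rw [ZMod.natCast_eq_zero_iff] at h2
  have := Nat.le_of_dvd (by omega) h2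
  omega

theorem outer_injective (hn : 3 ≤ n) : Function.Injective (outer (n := n)) := by
  intro i j h
  simp only [outer, Sym2.eq_iff, Sum.inl.injEq] at h
  rcases h with ⟨h, -⟩ | ⟨h₁, h₂⟩
  · exact h
  · exact absurd (by linear_combination h₂ - h₁) (one_add_one_ne_zero hn)

theorem mem_edgeSet_iff (hn : 3 ≤ n) (hk : (k : ZMod n) ≠ 0) (e : Sym2 (ZMod n ⊕ ZMod n)) :
    e ∈ (genPetersen n k).edgeSet ↔
      (∃ i, e = outer i) ∨ (∃ i, e = spoke i) ∨ ∃ i, e = inner (k : ZMod n) i := by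
  have h1 : (1 : ZMod n) ≠ 0 := fun h => one_add_one_ne_zero hn (by rw [h, add_zero])
  constructor
  · induction e using Sym2.ind with
    | _ a b =>
      rw [mem_edgeSet, genPetersen, fromRel_adj]
      rintro ⟨-, (⟨i, rfl, rfl⟩ | ⟨i, rfl, rfl⟩ | ⟨i, rfl, rfl⟩) |
        (⟨i, rfl, rfl⟩ | ⟨i, rfl, rfl⟩ | ⟨i, rfl, rfl⟩)⟩
      · exact Or.inl ⟨i, rfl⟩
      · exact Or.inr (Or.inl ⟨i, rfl⟩)
      · exact Or.inr (Or.inr ⟨i, rfl⟩)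
      · exact Or.inl ⟨i, Sym2.eq_swap⟩
      · exact Or.inr (Or.inl ⟨i, Sym2.eq_swap⟩)
      · exact Or.inr (Or.inr ⟨i, Sym2.eq_swap⟩)
  · rintro (⟨i, rfl⟩ | ⟨i, rfl⟩ | ⟨i, rfl⟩)
    · exact ⟨by simpa using h1, Or.inl (Or.inl ⟨i, rfl, rfl⟩)⟩
    · exact ⟨by simp, Or.inl (Or.inr (Or.inl ⟨i, rfl, rfl⟩))⟩
    · exact ⟨by simpa using hk, Or.inl (Or.inr (Or.inr ⟨i, rfl, rfl⟩))⟩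

theorem outer_mem_removed (hn : 3 ≤ n) {κ i : ZMod n} : outer i ∈ removed κ P Q ↔ P i := by
  constructor
  · rintro (⟨j, hj, h⟩ | ⟨j, -, h⟩ | ⟨j, -, h⟩)
    · rwa [outer_injective hn h]
    · exact absurd h (outer_ne_spoke i j)
    · exact absurd h (outer_ne_inner κ i j)
  · exact fun h => Or.inl ⟨i, h, rfl⟩

theorem spoke_mem_removed {κ i : ZMod n} : spoke i ∈ removed κ P Q ↔ Q i := by
  constructor
  · rintro (⟨j, -, h⟩ | ⟨j, hj, h⟩ | ⟨j, -, h⟩)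
    · exact absurd h.symm (outer_ne_spoke j i)
    · rwa [spoke_injective h]
    · exact absurd h (spoke_ne_inner κ i j)
  · exact fun h => Or.inr (Or.inl ⟨i, h, rfl⟩)

theorem inner_mem_removed {κ i : ZMod n} (hQ : κ + κ ≠ 0 ∨ ∀ i, ¬ Q i) :
    inner κ i ∈ removed κ P Q ↔ Q i := by
  constructor
  · rintro (⟨j, -, h⟩ | ⟨j, -, h⟩ | ⟨j, hj, h⟩)
    · exact absurd h.symm (outer_ne_inner κ j i)
    · exact absurd h.symm (spoke_ne_inner κ j i)
    · rcases hQ with hQ | hQ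
      · rwa [inner_injective hQ h]
      · exact absurd hj (hQ j)
  · exact fun h => Or.inr (Or.inr ⟨i, h, rfl⟩)

theorem removed_subset (hn : 3 ≤ n) (hk : (k : ZMod n) ≠ 0) :
    removed (k : ZMod n) P Q ⊆ (genPetersen n k).edgeSet := by
  rintro e (⟨i, -, rfl⟩ | ⟨i, -, rfl⟩ | ⟨i, -, rfl⟩) <;> rw [mem_edgeSet_iff hn hk]
  · exact Or.inl ⟨i, rfl⟩
  · exact Or.inr (Or.inl ⟨i, rfl⟩)
  · exact Or.inr (Or.inr ⟨i, rfl⟩)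

/-- The generalized Petersen graph without the edges in `removed k P Q`. -/
def kept (k : ℤ) (P Q : ZMod n → Prop) : SimpleGraph (ZMod n ⊕ ZMod n) :=
  (genPetersen n k).deleteEdges (removed (k : ZMod n) P Q)

theorem kept_adj_outer (hn : 3 ≤ n) (hk : (k : ZMod n) ≠ 0) {i : ZMod n} (h : ¬ P i) :
    (kept k P Q).Adj (Sum.inl i) (Sum.inl (i + 1)) := by
  rw [kept, deleteEdges_adj]
  exact ⟨(mem_edgeSet_iff hn hk _).2 (Or.inl ⟨i, rfl⟩), mt (outer_mem_removed hn).1 h⟩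

theorem kept_adj_spoke (hn : 3 ≤ n) (hk : (k : ZMod n) ≠ 0) {i : ZMod n} (h : ¬ Q i) :
    (kept k P Q).Adj (Sum.inl i) (Sum.inr i) := by
  rw [kept, deleteEdges_adj]
  exact ⟨(mem_edgeSet_iff hn hk _).2 (Or.inr (Or.inl ⟨i, rfl⟩)), mt spoke_mem_removed.1 h⟩

theorem kept_adj_inner (hn : 3 ≤ n) (hk : (k : ZMod n) ≠ 0)
    (hQ : (k : ZMod n) + k ≠ 0 ∨ ∀ i, ¬ Q i) {i : ZMod n} (h : ¬ Q i) :
    (kept k P Q).Adj (Sum.inr i) (Sum.inr (i + k)) := by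
  rw [kept, deleteEdges_adj]
  exact ⟨(mem_edgeSet_iff hn hk _).2 (Or.inr (Or.inr ⟨i, rfl⟩)), mt (inner_mem_removed hQ).1 h⟩

theorem ncard_edgeSet_kept_le [NeZero n] (hn : 3 ≤ n) (hk : (k : ZMod n) ≠ 0)
    (R : Set (ZMod n)) (hR : ∀ i, ¬ Q i → ∃ r ∈ R, inner (k : ZMod n) i = inner (k : ZMod n) r) :
    (kept k P Q).edgeSet.ncard ≤ {i | ¬ P i}.ncard + {i | ¬ Q i}.ncard + R.ncard := by
  have hsub : (kept k P Q).edgeSet ⊆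
      outer '' {i | ¬ P i} ∪ spoke '' {i | ¬ Q i} ∪ inner (k : ZMod n) '' R := by
    intro e he
    rw [kept, edgeSet_deleteEdges] at he
    obtain ⟨he, hS⟩ := he
    rcases (mem_edgeSet_iff hn hk e).1 he with ⟨i, rfl⟩ | ⟨i, rfl⟩ | ⟨i, rfl⟩
    · exact Or.inl (Or.inl ⟨i, fun h => hS (Or.inl ⟨i, h, rfl⟩), rfl⟩)
    · exact Or.inl (Or.inr ⟨i, fun h => hS (Or.inr (Or.inl ⟨i, h, rfl⟩)), rfl⟩)
    · obtain ⟨r, hr, h⟩ := hR i fun h => hS (Or.inr (Or.inr ⟨i, h, rfl⟩))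
      exact Or.inr ⟨r, hr, h.symm⟩
  calc (kept k P Q).edgeSet.ncard ≤ _ := Set.ncard_le_ncard hsub (Set.toFinite _)
    _ ≤ (outer '' {i | ¬ P i} ∪ spoke '' {i | ¬ Q i}).ncard + (inner (k : ZMod n) '' R).ncard :=
      Set.ncard_union_le _ _
    _ ≤ _ := by
      gcongr
      · refine (Set.ncard_union_le _ _).trans ?_
        gcongr <;> exact Set.ncard_image_le
      · exact Set.ncard_image_le

/-- If removing the outer edges with indices in an interval, together with the spokes and inner
edges with index in `Q`, leaves a connected graph with at most `2n - 1` edges, then the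
generalized Petersen graph is upper-embeddable. -/
theorem xi_le_one_of_kept [NeZero n] (hn : 3 ≤ n) (hk : (k : ZMod n) ≠ 0)
    (hQ : (k : ZMod n) + k ≠ 0 ∨ ∀ i, ¬ Q i) (s t : ℕ)
    (hP : ∀ i : ZMod n, P i ↔ s ≤ i.val ∧ i.val < t) (ht : t ≤ n)
    (hconn : (kept k P Q).Connected)
    (hcard : (kept k P Q).edgeSet.ncard + 1 ≤ 2 * n) :
    xi (genPetersen n k) ≤ 1 := by
  have hV : Nat.card (ZMod n ⊕ ZMod n) = 2 * n := by
    rw [Nat.card_sum, Nat.card_zmod, two_mul]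
  have hxi : xi (genPetersen n k) ≤ xiT (genPetersen n k) (kept k P Q) :=
    Nat.sInf_le ⟨kept k P Q, ⟨deleteEdges_le _,
      isTree_of_connected_of_ncard_edgeSet_lt hconn (hV ▸ hcard)⟩, rfl⟩
  refine hxi.trans ?_
  have hdiff : (genPetersen n k).edgeSet \ (kept k P Q).edgeSet = removed (k : ZMod n) P Q := by
    rw [kept, edgeSet_deleteEdges, sdiff_sdiff_right_self]
    exact inf_eq_right.2 (removed_subset hn hk)
  rw [xiT, hdiff]
  set D := fromEdgeSet (removed (k : ZMod n) P Q) with hDdef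
  have hD : D.edgeSet = removed (k : ZMod n) P Q := by
    rw [hDdef, edgeSet_fromEdgeSet]
    refine sdiff_eq_left.2 (Set.disjoint_left.2 fun e he => ?_)
    exact (genPetersen n k).not_isDiag_of_mem_edgeSet (removed_subset hn hk he)
  refine oddComps_le_one_s13 D (D.connectedComponentMk (Sum.inl (s : ZMod n))) {i | Q i}
    spoke (inner (k : ZMod n)) Sum.inr ?_ ?_ spoke_injective.injOn ?_
    (fun a _ b _ => spoke_ne_inner _ a b) ?_
  · exact fun a ha => ⟨hD ▸ spoke_mem_removed.2 ha, by simp [spoke]⟩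
  · exact fun a ha => ⟨hD ▸ (inner_mem_removed hQ).2 ha, by simp [inner]⟩
  · rcases hQ with hQ | hQ
    · exact (inner_injective hQ).injOn
    · exact fun a ha => absurd ha (hQ a)
  · rw [hD]
    rintro e (⟨i, hi, rfl⟩ | ⟨i, hi, rfl⟩ | ⟨i, hi, rfl⟩)
    · refine Or.inr ⟨Sum.inl i, by simp [outer], ConnectedComponent.sound (Reachable.symm ?_)⟩
      obtain ⟨h₁, h₂⟩ := (hP i).1 hi
      have := reachable_of_adj_succ (H := D) (fun j : ℕ => Sum.inl (j : ZMod n)) (s := s) (t := t)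
        (fun j hj hjt => by
          rw [← mem_edgeSet, hD, Nat.cast_succ]
          refine (outer_mem_removed hn).2 ((hP _).2 ?_)
          rw [ZMod.val_natCast_of_lt (by omega)]
          exact ⟨hj, hjt⟩) h₁ h₂.le
      simpa using this
    · exact Or.inl ⟨i, hi, Or.inl rfl⟩
    · exact Or.inl ⟨i, hi, Or.inr rfl⟩

theorem xi_le_one_of_two_mul_ne_zero [NeZero n] (hn : 3 ≤ n) (hk : (k : ZMod n) ≠ 0)
    (hkk : (k : ZMod n) + k ≠ 0) (d : ℕ) (hd : 0 < d) (hdn : 2 * d ≤ n) (hdvd : d ∣ n)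
    (hdk : (d : ℤ) ∣ k) (y : ℤ) (hy : (d : ZMod n) = y * k) :
    xi (genPetersen n k) ≤ 1 := by
  set P : ZMod n → Prop := fun i => 2 * d - 1 ≤ i.val ∧ i.val < n with hP
  set Q : ZMod n → Prop := fun i => i.val < d with hQ
  refine xi_le_one_of_kept (P := P) (Q := Q) hn hk (Or.inl hkk) (2 * d - 1) n
    (fun i => Iff.rfl) le_rfl ?_ ?_
  · rw [connected_iff_exists_forall_reachable]
    refine ⟨Sum.inl ((0 : ℕ) : ZMod n), ?_⟩
    have hpath : ∀ j : ℕ, j ≤ 2 * d - 1 →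
        (kept k P Q).Reachable (Sum.inl ((0 : ℕ) : ZMod n)) (Sum.inl (j : ZMod n)) := by
      intro j hj
      refine reachable_of_adj_succ (fun j : ℕ => Sum.inl (j : ZMod n)) (s := 0)
        (t := 2 * d - 1) (fun j _ hjt => ?_) (Nat.zero_le _) hj
      rw [Nat.cast_succ]
      refine kept_adj_outer hn hk ?_
      simp only [hP, ZMod.val_natCast_of_lt (show j < n by omega)]
      omega
    have hcycle : ∀ a : ℕ, a < d → ∀ j : ℕ, (kept k P Q).Reachable
        (Sum.inr ((a : ZMod n) + k)) (Sum.inr ((a : ZMod n) + (j + 1 : ℕ) * k)) := by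
      intro a ha j
      induction j with
      | zero => simp
      | succ j ih =>
        by_cases hq : Q ((a : ZMod n) + (j + 1 : ℕ) * k)
        · have heq : (a : ZMod n) + (j + 1 : ℕ) * k = a := by
            set b := (a : ZMod n) + (j + 1 : ℕ) * k with hb
            have hbv : ((b.val : ℤ) : ZMod n) = ((a + (j + 1 : ℕ) * k : ℤ) : ZMod n) := by
              push_cast
              rw [ZMod.natCast_zmod_val, hb]
              push_cast
              rfl
            rw [ZMod.intCast_eq_intCast_iff_dvd_sub] at hbv
            have h1 : (d : ℤ) ∣ (a + (j + 1 : ℕ) * k : ℤ) - b.val :=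
              (Int.natCast_dvd_natCast.2 hdvd).trans hbv
            have h2 : (d : ℤ) ∣ (a : ℤ) - b.val := by
              have := dvd_sub h1 (hdk.mul_left ((j + 1 : ℕ) : ℤ))
              rwa [add_sub_right_comm, add_sub_cancel_right] at this
            have h3 : a ≡ b.val [MOD d] :=
              (Nat.modEq_iff_dvd.2 (by simpa using (dvd_neg.2 h2)))
            have h4 : a = b.val := Nat.ModEq.eq_of_lt_of_lt h3 ha hq
            rw [h4, ZMod.natCast_zmod_val]
          have h2 : (a : ZMod n) + (j + 1 + 1 : ℕ) * k = a + k := by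
            rw [Nat.cast_succ (j + 1)]
            linear_combination heq
          rw [h2]
        · have := (kept_adj_inner (P := P) hn hk (Or.inl hkk) hq).reachable
          have h2 : (a : ZMod n) + (j + 1 : ℕ) * k + k = a + (j + 1 + 1 : ℕ) * k := by
            push_cast
            ring
          rw [h2] at this
          exact ih.trans this
    have hcoset : ∀ a : ℕ, a < d → ∀ q : ℕ, (kept k P Q).Reachable
        (Sum.inr ((a : ZMod n) + k)) (Sum.inr ((a + q * d : ℕ) : ZMod n)) := by
      intro a ha q
      have := hcycle a ha ((q * y - 1 : ℤ) : ZMod n).val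
      have h2 : (a : ZMod n) + (((q * y - 1 : ℤ) : ZMod n).val + 1 : ℕ) * k =
          (a + q * d : ℕ) := by
        push_cast
        rw [ZMod.natCast_zmod_val, hy]
        ring
      rwa [h2] at this
    have hv : ∀ i, (kept k P Q).Reachable (Sum.inl ((0 : ℕ) : ZMod n)) (Sum.inr i) := by
      intro i
      have ha : i.val % d < d := Nat.mod_lt _ hd
      have h1 := hcoset _ ha (i.val / d)
      rw [Nat.mod_add_div', ZMod.natCast_zmod_val] at h1
      have h2 := hcoset _ ha 1
      have h3 : (kept k P Q).Adj (Sum.inl ((i.val % d + 1 * d : ℕ) : ZMod n)) (Sum.inr _) :=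
        kept_adj_spoke hn hk (by
          simp only [hQ, ZMod.val_natCast_of_lt (show i.val % d + 1 * d < n by omega)]
          omega)
      exact (hpath _ (by omega)).trans (h3.reachable.trans (h2.symm.trans h1))
    rintro (i | i)
    · by_cases hq : Q i
      · have := hpath i.val (by simp only [hQ] at hq; omega)
        rwa [ZMod.natCast_zmod_val] at this
      · exact (hv i).trans (kept_adj_spoke hn hk hq).reachable.symm
    · exact hv i
  · have h := ncard_edgeSet_kept_le (P := P) hn hk {i | ¬ Q i} (fun i hi => ⟨i, hi, rfl⟩)
    have h1 : {i | ¬ P i}.ncard ≤ 2 * d - 1 - 0 :=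
      le_trans (Set.ncard_le_ncard (fun i hi => by
        have := ZMod.val_lt i
        simp only [hP, Set.mem_ofPred_eq] at hi ⊢
        omega) (Set.toFinite _)) (ZMod.ncard_val_mem_Ico_le 0 (2 * d - 1))
    have h2 : {i | ¬ Q i}.ncard ≤ n - d :=
      le_trans (Set.ncard_le_ncard (fun i hi => by
        have := ZMod.val_lt i
        simp only [hQ, Set.mem_ofPred_eq] at hi ⊢
        omega) (Set.toFinite _))
        (ZMod.ncard_val_mem_Ico_le d n)
    omega

theorem xi_le_one_of_eq_half [NeZero n] (hn : 3 ≤ n) (hk : (k : ZMod n) ≠ 0) (d : ℕ)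
    (hdn : n = 2 * d) (hkd : (k : ZMod n) = d) : xi (genPetersen n k) ≤ 1 := by
  have hdd : (d : ZMod n) + d = 0 := by
    rw [← Nat.cast_add, ← two_mul, ← hdn, ZMod.natCast_self]
  set P : ZMod n → Prop := fun i => 0 ≤ i.val ∧ i.val < d + 1 with hP
  set Q : ZMod n → Prop := fun _ => False with hQ
  have hQ' : ∀ i, ¬ Q i := fun _ => id
  refine xi_le_one_of_kept (P := P) (Q := Q) hn hk (Or.inr hQ') 0 (d + 1)
    (fun i => Iff.rfl) (by omega) ?_ ?_
  · rw [connected_iff_exists_forall_reachable]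
    refine ⟨Sum.inl ((d + 1 : ℕ) : ZMod n), ?_⟩
    have hpath : ∀ j : ℕ, d + 1 ≤ j → j ≤ n →
        (kept k P Q).Reachable (Sum.inl ((d + 1 : ℕ) : ZMod n)) (Sum.inl (j : ZMod n)) := by
      intro j hdj hj
      refine reachable_of_adj_succ (fun j : ℕ => Sum.inl (j : ZMod n)) (s := d + 1)
        (t := n) (fun j hdj hjt => ?_) hdj hj
      rw [Nat.cast_succ]
      refine kept_adj_outer hn hk ?_
      simp only [hP, ZMod.val_natCast_of_lt hjt]
      omega
    have hu : ∀ i, (kept k P Q).Reachable (Sum.inl ((d + 1 : ℕ) : ZMod n)) (Sum.inl i) := by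
      intro i
      have hi := ZMod.val_lt i
      rcases Nat.lt_or_ge d i.val with h | h
      · simpa using hpath i.val h hi.le
      rcases Nat.eq_zero_or_pos i.val with h0 | h0
      · have := hpath n (by omega) le_rfl
        rw [(ZMod.val_eq_zero i).1 h0]
        simpa using this
      · have h1 := hpath (i.val + d) (by omega) (by omega)
        rw [Nat.cast_add i.val, ZMod.natCast_zmod_val, ← hkd] at h1
        exact h1.trans ((kept_adj_spoke hn hk (hQ' _)).reachable.trans
          ((kept_adj_inner hn hk (Or.inr hQ') (hQ' i)).reachable.symm.trans
            (kept_adj_spoke hn hk (hQ' i)).reachable.symm))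
    rintro (i | i)
    · exact hu i
    · exact (hu i).trans (kept_adj_spoke hn hk (hQ' i)).reachable
  · have h := ncard_edgeSet_kept_le (P := P) (Q := Q) hn hk {i | 0 ≤ i.val ∧ i.val < d}
      (fun i _ => by
        have hi := ZMod.val_lt i
        rcases Nat.lt_or_ge i.val d with h | h
        · exact ⟨i, ⟨Nat.zero_le _, h⟩, rfl⟩
        · have hcast : ((i.val - d : ℕ) : ZMod n) = i + k := by
            rw [Nat.cast_sub h, ZMod.natCast_zmod_val, hkd]
            linear_combination -hdd
          refine ⟨i + k, ⟨Nat.zero_le _, ?_⟩, ?_⟩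
          · rw [← hcast, ZMod.val_natCast_of_lt (by omega)]
            omega
          · rw [inner, inner, add_assoc, hkd, hdd, add_zero]
            exact Sym2.eq_swap)
    have h1 : {i | ¬ P i}.ncard ≤ n - (d + 1) :=
      le_trans (Set.ncard_le_ncard (fun i hi => by
        have := ZMod.val_lt i
        simp only [hP, Set.mem_ofPred_eq] at hi ⊢
        omega) (Set.toFinite _)) (ZMod.ncard_val_mem_Ico_le (d + 1) n)
    have h2 : {i | ¬ Q i}.ncard ≤ n := by
      refine (Set.ncard_le_card _).trans_eq ?_
      rw [Nat.card_zmod]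
    have h3 := ZMod.ncard_val_mem_Ico_le (n := n) 0 d
    omega

end GenPetersen

/-- For `n ≥ 3` and an integer `k ≢ 0 (mod n)`, the generalized
Petersen graph `P(n, k)` is upper-embeddable: `ξ(P(n,k)) ≤ 1`. -/
theorem genPetersen_upper_embeddable (n : ℕ) (hn : 3 ≤ n)
    (k : ℤ) (hk : (k : ZMod n) ≠ 0) :
    xi (genPetersen n k) ≤ 1 := by
  have : NeZero n := ⟨by omega⟩
  set d := Int.gcd n k with hd
  have hdn : d ∣ n := Int.natCast_dvd_natCast.1 (Int.gcd_dvd_left _ _)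
  have hdk : (d : ℤ) ∣ k := Int.gcd_dvd_right _ _
  have hd0 : 0 < d := Nat.pos_of_dvd_of_pos hdn (by omega)
  have hnk : ¬ (n : ℤ) ∣ k := mt (ZMod.intCast_zmod_eq_zero_iff_dvd k n).2 hk
  have hne : d ≠ n := fun h => hnk (h ▸ hdk)
  have h2d : 2 * d ≤ n := by
    obtain ⟨c, hc⟩ := hdn
    rcases c with _ | _ | c
    · omega
    · omega
    · nlinarith
  by_cases hkk : (k : ZMod n) + k = 0
  · have h2k : (n : ℤ) ∣ 2 * k := by
      rw [← ZMod.intCast_zmod_eq_zero_iff_dvd]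
      push_cast
      linear_combination hkk
    have hn2 : n ∣ 2 * d := by
      have h := Int.dvd_coe_gcd (Dvd.intro_left 2 rfl : (n : ℤ) ∣ 2 * n) h2k
      rw [Int.gcd_mul_left] at h
      exact_mod_cast h
    have hn' : n = 2 * d := le_antisymm (Nat.le_of_dvd (by omega) hn2) h2d
    refine GenPetersen.xi_le_one_of_eq_half hn hk d hn' ?_
    obtain ⟨t, ht⟩ := hdk
    rcases Int.even_or_odd' t with ⟨r, rfl | rfl⟩
    · refine absurd ⟨r, ?_⟩ hnk
      rw [ht, hn']
      push_cast
      ring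
    · have h0 : ((2 * d : ℕ) : ZMod n) = 0 := by rw [← hn', ZMod.natCast_self]
      rw [ht]
      push_cast at h0 ⊢
      linear_combination (r : ZMod n) * h0
  · refine GenPetersen.xi_le_one_of_two_mul_ne_zero hn hk hkk d hd0 h2d hdn hdk
      (Int.gcdB n k) ?_
    have h := congrArg (Int.cast : ℤ → ZMod n) (Int.gcd_eq_gcd_ab n k)
    push_cast at h
    rw [ZMod.natCast_self, zero_mul, zero_add] at h
    rw [mul_comm]
    exact h
end

section
/- Let G be a finite connected simple graph. For every spanning tree T of G, ξ(G,T) ≡ β(G) (mod 2); in particular, the Betti deficiency satisfies ξ(G) ≡ β(G) (mod 2), and for any two spanning trees T₁ and T₂, ξ(G,T₁) ≡ ξ(G,T₂) (mod 2). -/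
open SimpleGraph

/-- Every edge of `D` lies in exactly one connected component of `D`. -/
theorem sum_compEdgeCount {V : Type*} [Finite V] (D : SimpleGraph V)
    [Fintype D.ConnectedComponent] :
    ∑ c, compEdgeCount D c = D.edgeSet.ncard := by
  have hunion : D.edgeSet =
      ⋃ c, {e ∈ D.edgeSet | ∀ v ∈ e, D.connectedComponentMk v = c} := by
    ext e
    induction e with | h u v
    simp only [Set.mem_iUnion, Set.mem_ofPred_eq, Sym2.mem_iff]
    refine ⟨fun h ↦ ⟨D.connectedComponentMk v, h, ?_⟩, fun ⟨_, h, _⟩ ↦ h⟩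
    rintro w (rfl | rfl)
    · exact ConnectedComponent.sound (Adj.reachable h)
    · rfl
  have hdisj : Pairwise (Function.onFun Disjoint
      fun c ↦ {e ∈ D.edgeSet | ∀ v ∈ e, D.connectedComponentMk v = c}) := by
    refine fun c d hcd ↦ Set.disjoint_left.2 fun e he he' ↦ hcd ?_
    exact (he.2 _ e.out_fst_mem).symm.trans (he'.2 _ e.out_fst_mem)
  conv_rhs => rw [hunion]
  rw [Set.ncard_iUnion_of_finite (fun _ ↦ Set.toFinite _) hdisj, finsum_eq_sum_of_fintype]
  rfl

theorem oddComps_modEq_ncard_edgeSet {V : Type*} [Finite V] (D : SimpleGraph V) :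
    oddComps D ≡ D.edgeSet.ncard [MOD 2] := by
  classical
  have := Fintype.ofFinite D.ConnectedComponent
  have h := Finset.odd_sum_iff_odd_card_odd (s := Finset.univ) (compEdgeCount D)
  rw [sum_compEdgeCount, ← Set.ncard_coe_finset] at h
  simp only [Finset.coe_filter, Finset.mem_univ, true_and] at h
  change Odd _ ↔ Odd (oddComps D) at h
  rw [Nat.odd_iff, Nat.odd_iff] at h
  unfold Nat.ModEq
  omega

/-- The complement of a spanning tree of `G` has `β(G)` edges. -/
theorem ncard_edgeSet_diff_spanningTree {V : Type*} [Finite V] {G T : SimpleGraph V}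
    (hT : IsSpanningTree G T) :
    (fromEdgeSet (G.edgeSet \ T.edgeSet)).edgeSet.ncard = betti G := by
  have hfrom : (fromEdgeSet (G.edgeSet \ T.edgeSet)).edgeSet = G.edgeSet \ T.edgeSet := by
    rw [edgeSet_fromEdgeSet, sdiff_eq_left, Set.disjoint_left]
    exact fun e he ↦ G.not_isDiag_of_mem_edgeSet he.1
  have hsub : T.edgeSet ⊆ G.edgeSet := edgeSet_mono hT.1
  have hcard := (isTree_iff_connected_and_card.1 hT.2).2
  rw [Nat.card_coe_set_eq] at hcard
  rw [hfrom, Set.ncard_sdiff hsub, betti]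
  omega

theorem xiT_modEq_betti {V : Type*} [Finite V] {G T : SimpleGraph V}
    (hT : IsSpanningTree G T) : xiT G T ≡ betti G [MOD 2] := by
  rw [← ncard_edgeSet_diff_spanningTree hT]
  exact oddComps_modEq_ncard_edgeSet _

/-- The minimum defining the Betti deficiency is attained by some spanning tree. -/
theorem exists_xiT_eq_xi {V : Type*} [Finite V] {G : SimpleGraph V} (hG : G.Connected) :
    ∃ T, IsSpanningTree G T ∧ xiT G T = xi G := by
  obtain ⟨T, hT⟩ := hG.exists_isTree_le
  exact Nat.sInf_mem (s := {n | ∃ T, IsSpanningTree G T ∧ xiT G T = n}) ⟨_, T, hT, rfl⟩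

/-- For every spanning tree `T` of a connected graph `G`,
`ξ(G,T) ≡ β(G) (mod 2)`; in particular `ξ(G) ≡ β(G) (mod 2)` and any two spanning trees
give values of `ξ(G,·)` of the same parity. -/
theorem xiT_parity {V : Type*} [Finite V] (G : SimpleGraph V) (hG : G.Connected) :
    (∀ T, IsSpanningTree G T → xiT G T ≡ betti G [MOD 2]) ∧
    xi G ≡ betti G [MOD 2] ∧
    ∀ T₁ T₂, IsSpanningTree G T₁ → IsSpanningTree G T₂ →
      xiT G T₁ ≡ xiT G T₂ [MOD 2] := by
  refine ⟨fun _ ↦ xiT_modEq_betti, ?_, fun _ _ h₁ h₂ ↦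
    (xiT_modEq_betti h₁).trans (xiT_modEq_betti h₂).symm⟩
  obtain ⟨T, hT, h⟩ := exists_xiT_eq_xi hG
  exact h ▸ xiT_modEq_betti hT
end
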